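/- Let v* ∈ 𝓜 ∩ S^{d−1}, λ > 0, Σ := λ v* v*ᵀ + I_d, let Σ̂ be a symmetric positive semidefinite d×d matrix, and W := Σ̂ − Σ. Suppose λ > 2ρ(W, F*) and t2(λ) < 1. If a projected power iterate satisfies v_t ∈ 𝔾(λ), then the next iterate satisfies ‖v_{t+1} − v*‖₂ ≤ (1/2) · ‖v_t − v*‖₂ + 2.5 ρ(W, F*)/(λ − 2ρ(W, F*)). -/

import Mathlib

open MeasureTheory ProbabilityTheory Matrix Finset

noncomputable section

namespace StructuredPCA

/-- Euclidean inner product on `Fin d → ℝ`. -/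
def ip {d : ℕ} (u v : Fin d → ℝ) : ℝ := ∑ i, u i * v i

/-- Euclidean norm on `Fin d → ℝ`. -/
def nrm {d : ℕ} (v : Fin d → ℝ) : ℝ := Real.sqrt (∑ i, v i ^ 2)

/-- Quadratic form `vᵀ A v`. -/
def quad {d : ℕ} (A : Matrix (Fin d) (Fin d) ℝ) (v : Fin d → ℝ) : ℝ := ip v (A.mulVec v)

/-- `ρ(A, S) = sup { |vᵀ A v| : v ∈ S, ‖v‖ = 1 }`. -/
def rho {d : ℕ} (A : Matrix (Fin d) (Fin d) ℝ) (S : Set (Fin d → ℝ)) : ℝ :=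
  sSup {x : ℝ | ∃ v ∈ S, nrm v = 1 ∧ x = |quad A v|}

/-- Frobenius norm of a matrix. -/
def frob {d : ℕ} (A : Matrix (Fin d) (Fin d) ℝ) : ℝ :=
  Real.sqrt (∑ i, ∑ j, A i j ^ 2)

/-- Operator (spectral) norm of a matrix. -/
def opNorm {d : ℕ} (A : Matrix (Fin d) (Fin d) ℝ) : ℝ :=
  sSup {x : ℝ | ∃ v, nrm v = 1 ∧ x = nrm (A.mulVec v)}

/-- The spiked covariance `λ v* v*ᵀ + I`. -/
def spikedCov {d : ℕ} (lam : ℝ) (vstar : Fin d → ℝ) : Matrix (Fin d) (Fin d) ℝ :=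
  lam • vecMulVec vstar vstar + 1

/-- `x 1, …, x n` are spiked Wishart samples with spike `v*`:
`x i = √λ g i • v* + z i` with `g, z` i.i.d. standard normal, mutually independent. -/
def IsSpikedWishart {d n : ℕ} {Ω : Type*} [MeasurableSpace Ω] (μ : Measure Ω)
    (lam : ℝ) (vstar : Fin d → ℝ) (x : Fin n → Ω → Fin d → ℝ) : Prop :=
  ∃ G : (Fin n ⊕ Fin n × Fin d) → Ω → ℝ,
    (∀ i, Measurable (G i)) ∧
    iIndepFun G μ ∧
    (∀ i, μ.map (G i) = gaussianReal 0 1) ∧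
    ∀ i ω j, x i ω j = Real.sqrt lam * G (Sum.inl i) ω * vstar j + G (Sum.inr (i, j)) ω

/-- The sample covariance matrix `n⁻¹ ∑ xᵢ xᵢᵀ`. -/
def sampleCov {d n : ℕ} {Ω : Type*} (x : Fin n → Ω → Fin d → ℝ) (ω : Ω) :
    Matrix (Fin d) (Fin d) ℝ :=
  (n : ℝ)⁻¹ • ∑ i, vecMulVec (x i ω) (x i ω)

/-- Union-of-linear-structures data: an orthonormal basis `φ` and subsets `Bs m`. -/
structure UnionStruct (d M : ℕ) where
  φ : Fin d → Fin d → ℝ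
  orthonormal : ∀ i j, ip (φ i) (φ j) = if i = j then 1 else 0
  Bs : Fin M → Finset (Fin d)

/-- The subspace `L m = span (B m)`. -/
def UnionStruct.L {d M : ℕ} (U : UnionStruct d M) (m : Fin M) : Submodule ℝ (Fin d → ℝ) :=
  Submodule.span ℝ (U.φ '' (U.Bs m : Set (Fin d)))

/-- The union `𝓜 = ⋃ m, L m`. -/
def UnionStruct.carrier {d M : ℕ} (U : UnionStruct d M) : Set (Fin d → ℝ) :=
  ⋃ m, (U.L m : Set (Fin d → ℝ))

/-- A `(d,k)`-layered graph. -/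
structure LayeredGraph (d k : ℕ) where
  vs : Fin d
  vt : Fin d
  hst : vs ≠ vt
  V : Fin k → Finset (Fin d)
  hvs : ∀ j, vs ∉ V j
  hvt : ∀ j, vt ∉ V j
  hdisj : ∀ j j', j ≠ j' → Disjoint (V j) (V j')
  hdvd : k ∣ (d - 2)
  hcard : ∀ j, (V j).card = (d - 2) / k
  hcover : ∀ i, i ≠ vs → i ≠ vt → ∃ j, i ∈ V j

/-- A member of `P^k`: contains `v_s`, `v_t` and exactly one vertex of each layer. -/
def LayeredGraph.IsPathSet {d k : ℕ} (G : LayeredGraph d k) (P : Finset (Fin d)) : Prop :=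
  G.vs ∈ P ∧ G.vt ∈ P ∧ ∀ j, (P ∩ G.V j).card = 1

/-- `v` is `k`-path-sparse. -/
def LayeredGraph.PathSparse {d k : ℕ} (G : LayeredGraph d k) (v : Fin d → ℝ) : Prop :=
  ∃ P, G.IsPathSet P ∧ ∀ i, v i ≠ 0 → i ∈ P

/-- A member of `T^k`: a `k`-element rooted connected subtree of the complete binary
tree on nodes `1, …, d` (node `i ≥ 2` has parent `i / 2`). -/
def IsTreeSet (d k : ℕ) (T : Finset ℕ) : Prop :=
  T.card = k ∧ 1 ∈ T ∧ (∀ i ∈ T, 1 ≤ i ∧ i ≤ d) ∧ ∀ i ∈ T, 2 ≤ i → i / 2 ∈ T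

/-- `v` is `k`-tree-sparse (coordinate `i : Fin d` corresponds to node `i + 1`). -/
def TreeSparse (d k : ℕ) (v : Fin d → ℝ) : Prop :=
  ∃ T, IsTreeSet d k T ∧ ∀ i : Fin d, v i ≠ 0 → (i : ℕ) + 1 ∈ T

/-- The index of the parent node: coordinate `i` is node `i+1`, whose parent is `(i+1)/2`. -/
def parentIdx {d : ℕ} (i : Fin d) : Fin d :=
  ⟨((i : ℕ) + 1) / 2 - 1, by have := i.isLt; omega⟩

/-- The feasible set of the SDP relaxation for tree-sparse PCA. -/
def sdpFeasible (d k : ℕ) : Set (Matrix (Fin d) (Fin d) ℝ) :=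
  {Mm | Mm.PosSemidef ∧ (∑ i, Mm i i) = 1 ∧ (∑ i, ∑ j, |Mm i j|) ≤ (k : ℝ) ∧
    ∀ i : Fin d, 2 ≤ (i : ℕ) + 1 → Mm i i ≤ Mm (parentIdx i) (parentIdx i)}


lemma ip_eq {d : ℕ} (u v : Fin d → ℝ) : ip u v = u ⬝ᵥ v := rfl

lemma nrm_sq {d : ℕ} (v : Fin d → ℝ) : nrm v ^ 2 = v ⬝ᵥ v := by
  unfold nrm
  rw [Real.sq_sqrt (Finset.sum_nonneg fun i _ => sq_nonneg _)]
  simp [dotProduct, sq]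

lemma nrm_nonneg {d : ℕ} (v : Fin d → ℝ) : 0 ≤ nrm v := Real.sqrt_nonneg _

lemma nrm_smul {d : ℕ} (c : ℝ) (v : Fin d → ℝ) : nrm (c • v) = |c| * nrm v := by
  rw [← abs_of_nonneg (nrm_nonneg (c • v)), ← abs_of_nonneg (nrm_nonneg v), ← abs_mul,
    ← sq_eq_sq_iff_abs_eq_abs, mul_pow, nrm_sq, nrm_sq]
  simp
  ring

lemma dot_le {d : ℕ} (u v : Fin d → ℝ) : u ⬝ᵥ v ≤ nrm u * nrm v := by
  have h := Finset.sum_mul_sq_le_sq_mul_sq Finset.univ u v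
  have h2 : (u ⬝ᵥ v) ^ 2 ≤ (nrm u * nrm v) ^ 2 := by
    rw [mul_pow, nrm_sq, nrm_sq]
    simpa [dotProduct, sq] using h
  exact (abs_le_of_sq_le_sq' h2 (mul_nonneg (nrm_nonneg u) (nrm_nonneg v))).2

lemma quad_bdd {d : ℕ} (A : Matrix (Fin d) (Fin d) ℝ) (S : Set (Fin d → ℝ)) :
    BddAbove {x : ℝ | ∃ v ∈ S, nrm v = 1 ∧ x = |quad A v|} := by
  refine ⟨∑ i, ∑ j, |A i j|, ?_⟩
  rintro x ⟨v, -, hv, rfl⟩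
  have hc : ∀ i, |v i| ≤ 1 := by
    intro i
    have h1 : ∑ i, v i ^ 2 = 1 := by
      unfold nrm at hv
      exact (Real.sqrt_eq_one).1 hv
    have h2 : v i ^ 2 ≤ ∑ i, v i ^ 2 :=
      Finset.single_le_sum (f := fun i => v i ^ 2) (fun i _ => sq_nonneg _) (Finset.mem_univ i)
    exact (sq_le_one_iff_abs_le_one _).1 (h2.trans h1.le)
  unfold quad ip Matrix.mulVec dotProduct
  refine (Finset.abs_sum_le_sum_abs _ _).trans (Finset.sum_le_sum fun i _ => ?_)
  rw [abs_mul]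
  calc |v i| * |∑ j, A i j * v j| ≤ 1 * |∑ j, A i j * v j| :=
        mul_le_mul_of_nonneg_right (hc i) (abs_nonneg _)
    _ ≤ ∑ j, |A i j * v j| := by rw [one_mul]; exact Finset.abs_sum_le_sum_abs _ _
    _ ≤ ∑ j, |A i j| := Finset.sum_le_sum fun j _ => by
        rw [abs_mul]; exact mul_le_of_le_one_right (abs_nonneg _) (hc j)

lemma rho_nonneg {d : ℕ} (A : Matrix (Fin d) (Fin d) ℝ) (S : Set (Fin d → ℝ)) :
    0 ≤ rho A S := by
  apply Real.sSup_nonneg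
  rintro x ⟨v, -, -, rfl⟩
  exact abs_nonneg _

lemma quad_le {d : ℕ} (A : Matrix (Fin d) (Fin d) ℝ) (F : Submodule ℝ (Fin d → ℝ))
    (v : Fin d → ℝ) (hv : v ∈ F) :
    |v ⬝ᵥ A *ᵥ v| ≤ rho A (F : Set (Fin d → ℝ)) * nrm v ^ 2 := by
  by_cases h0 : nrm v = 0
  · have h1 : v = 0 := by
      have := nrm_sq v
      rw [h0] at this
      exact dotProduct_self_eq_zero.1 (by linarith)
    subst h1
    simp [h0]
  · have hpos : 0 < nrm v := lt_of_le_of_ne (nrm_nonneg v) (Ne.symm h0)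
    have h1 : |quad A ((nrm v)⁻¹ • v)| ≤ rho A (F : Set (Fin d → ℝ)) := by
      refine le_csSup (quad_bdd A _) ⟨_, F.smul_mem _ hv, ?_, rfl⟩
      rw [nrm_smul, abs_of_pos (inv_pos.2 hpos), inv_mul_cancel₀ h0]
    have h2 : v ⬝ᵥ A *ᵥ v = quad A ((nrm v)⁻¹ • v) * nrm v ^ 2 := by
      unfold quad
      rw [ip_eq, mulVec_smul, smul_dotProduct, dotProduct_smul, smul_eq_mul, smul_eq_mul]
      field_simp
    rw [h2, abs_mul, abs_of_nonneg (sq_nonneg (nrm v))]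
    exact mul_le_mul_of_nonneg_right h1 (sq_nonneg _)

lemma bil_le {d : ℕ} (A : Matrix (Fin d) (Fin d) ℝ) (hA : Aᵀ = A)
    (F : Submodule ℝ (Fin d → ℝ)) (x y : Fin d → ℝ) (hx : x ∈ F) (hy : y ∈ F)
    (hy1 : nrm y = 1) :
    x ⬝ᵥ A *ᵥ y ≤ rho A (F : Set (Fin d → ℝ)) * nrm x := by
  by_cases h0 : nrm x = 0
  · have h1 : x = 0 := by
      have := nrm_sq x
      rw [h0] at this
      exact dotProduct_self_eq_zero.1 (by linarith)
    subst h1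
    simp [h0]
  · have hpos : 0 < nrm x := lt_of_le_of_ne (nrm_nonneg x) (Ne.symm h0)
    obtain ⟨u, hu⟩ : ∃ u, u = (nrm x)⁻¹ • x := ⟨_, rfl⟩
    have huF : u ∈ F := hu ▸ F.smul_mem _ hx
    have hu1 : nrm u = 1 := by
      rw [hu, nrm_smul, abs_of_pos (inv_pos.2 hpos), inv_mul_cancel₀ h0]
    have hxu : x = nrm x • u := by rw [hu, smul_smul, mul_inv_cancel₀ h0, one_smul]
    have p := (abs_le.1 (quad_le A F (u + y) (F.add_mem huF hy))).2
    have q := (abs_le.1 (quad_le A F (u - y) (F.sub_mem huF hy))).1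
    have hs : y ⬝ᵥ A *ᵥ u = u ⬝ᵥ A *ᵥ y := by
      rw [dotProduct_mulVec, ← mulVec_transpose, hA, dotProduct_comm]
    have eu := nrm_sq u
    have ey := nrm_sq y
    rw [hu1] at eu
    rw [hy1] at ey
    rw [nrm_sq] at p q
    simp only [mulVec_add, mulVec_sub, add_dotProduct, sub_dotProduct, dotProduct_add,
      dotProduct_sub, hs, ← eu, ← ey, dotProduct_comm y u] at p q
    have key : u ⬝ᵥ A *ᵥ y ≤ rho A (F : Set (Fin d → ℝ)) := by nlinarith
    calc x ⬝ᵥ A *ᵥ y = nrm x * (u ⬝ᵥ A *ᵥ y) := by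
          conv_lhs => rw [hxu]
          rw [smul_dotProduct, smul_eq_mul]
      _ ≤ nrm x * rho A (F : Set (Fin d → ℝ)) := mul_le_mul_of_nonneg_left key hpos.le
      _ = _ := mul_comm _ _

/-- The scalar inequality behind the one-step contraction. -/
lemma scalar_step (l r a e δ : ℝ) (hr : 0 ≤ r) (hgap : 2 * r < l)
    (ht2 : 4 / (l + 1 - r) + 10 * r / (l - 2 * r) < 1)
    (hgood : 4 / (l + 1 - r) + 5 * r / (l - 2 * r) ≤ a)
    (he : 0 ≤ e) (hea : e ^ 2 = 2 - 2 * a) (hd : 0 ≤ δ)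
    (h : l * a * (δ ^ 2 / 2) ≤ δ * e - δ ^ 2 / 2 + r * δ) :
    δ ≤ (1 / 2) * e + 2.5 * r / (l - 2 * r) := by
  have hg : 0 < l - 2 * r := by linarith
  have hp : 0 < l + 1 - r := by linarith
  have hl : 3 < l := by
    have h1 : 0 ≤ 10 * r / (l - 2 * r) := by positivity
    have h2 : 4 / (l + 1 - r) < 1 := by linarith
    rw [div_lt_one hp] at h2
    linarith
  have hA : 3 ≤ l * (4 / (l + 1 - r)) := by
    rw [← mul_div_assoc, le_div_iff₀ hp]; linarith
  have hB : 5 * r ≤ l * (5 * r / (l - 2 * r)) := by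
    rw [← mul_div_assoc, le_div_iff₀ hg]; nlinarith [mul_nonneg hr hr]
  have hla : 3 + 5 * r ≤ l * a := by
    have := mul_le_mul_of_nonneg_left hgood (by linarith : 0 ≤ l)
    linarith [mul_add l (4 / (l + 1 - r)) (5 * r / (l - 2 * r))]
  have ha : 0 < a := by
    by_contra hn
    nlinarith
  have h2 : (l * a + 1) * δ ≤ 2 * (e + r) := by
    rcases hd.eq_or_lt with h0 | h0
    · rw [← h0]; linarith
    · refine le_of_mul_le_mul_left ?_ h0
      nlinarith
  have hR : r * a ≤ (l * a + 1) * (r / (l - 2 * r)) := by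
    rw [← mul_div_assoc, le_div_iff₀ hg]
    nlinarith [mul_nonneg hr hr, mul_nonneg (mul_nonneg hr hr) ha.le]
  have he2 : e ≤ 2 := by nlinarith
  have hea2 : 1 ≤ e + a := by nlinarith
  have h3 : r * 1 ≤ r * (e + a) := mul_le_mul_of_nonneg_left hea2 hr
  have h4 : (3 + 5 * r) * e ≤ l * a * e := mul_le_mul_of_nonneg_right hla he
  have hpos : 0 < l * a + 1 := by linarith
  refine le_of_mul_le_mul_left ?_ hpos
  have : 2.5 * r / (l - 2 * r) = 2.5 * (r / (l - 2 * r)) := by ring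
  rw [this]
  nlinarith

/-- one-step contraction: if the projected power iterate `v_t`
lies in the good region `𝔾(λ)`, then
`‖v_{t+1} − v*‖ ≤ (1/2)‖v_t − v*‖ + 2.5 ρ(W,F*)/(λ − 2ρ(W,F*))`. -/
theorem projected_power_method_one_step
    {d M : ℕ} (U : UnionStruct d M)
    (vstar : Fin d → ℝ) (hvstar_mem : vstar ∈ U.carrier) (hvstar_nrm : nrm vstar = 1)
    (lam : ℝ) (hlam : 0 < lam)
    (Sighat : Matrix (Fin d) (Fin d) ℝ) (hpsd : Sighat.PosSemidef)
    (W : Matrix (Fin d) (Fin d) ℝ) (hW : W = Sighat - spikedCov lam vstar)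
    (Fstar : Submodule ℝ (Fin d → ℝ))
    (hFstar_form : ∃ m1 m2 m3 : Fin M, Fstar = U.L m1 ⊔ U.L m2 ⊔ U.L m3)
    (hFstar_max : ∀ m1 m2 m3 : Fin M,
      rho W ((U.L m1 ⊔ U.L m2 ⊔ U.L m3 : Submodule ℝ (Fin d → ℝ)) : Set (Fin d → ℝ)) ≤
        rho W (Fstar : Set (Fin d → ℝ)))
    (hgap : 2 * rho W (Fstar : Set (Fin d → ℝ)) < lam)
    (ht2 : 4 / (lam + 1 - rho W (Fstar : Set (Fin d → ℝ))) +
        10 * rho W (Fstar : Set (Fin d → ℝ)) / (lam - 2 * rho W (Fstar : Set (Fin d → ℝ))) < 1)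
    (vt : Fin d → ℝ) (hvt_mem : vt ∈ U.carrier) (hvt_nrm : nrm vt = 1)
    (hgood : 4 / (lam + 1 - rho W (Fstar : Set (Fin d → ℝ))) +
        5 * rho W (Fstar : Set (Fin d → ℝ)) / (lam - 2 * rho W (Fstar : Set (Fin d → ℝ))) ≤
          ip vt vstar)
    (vt1 : Fin d → ℝ) (hvt1_mem : vt1 ∈ U.carrier) (hvt1_nrm : nrm vt1 = 1)
    (hmax : ∀ u ∈ U.carrier, nrm u = 1 →
        ip u (Sighat.mulVec vt) ≤ ip vt1 (Sighat.mulVec vt)) :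
    nrm (vt1 - vstar) ≤
      (1 / 2) * nrm (vt - vstar) +
        2.5 * rho W (Fstar : Set (Fin d → ℝ)) / (lam - 2 * rho W (Fstar : Set (Fin d → ℝ))) := by
  obtain ⟨m1, hm1⟩ := Set.mem_iUnion.1 hvstar_mem
  obtain ⟨m2, hm2⟩ := Set.mem_iUnion.1 hvt_mem
  obtain ⟨m3, hm3⟩ := Set.mem_iUnion.1 hvt1_mem
  have hF := hFstar_max m1 m2 m3
  have hr := rho_nonneg W (Fstar : Set (Fin d → ℝ))
  have hS : Sighat = W + (lam • vecMulVec vstar vstar + 1) := by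
    rw [hW]; unfold spikedCov; abel
  have hWs : Wᵀ = W := by
    have h1 : Sighatᵀ = Sighat := by
      have := hpsd.1.eq
      rwa [conjTranspose_eq_transpose_of_trivial] at this
    rw [hW]; unfold spikedCov
    simp [transpose_sub, h1, transpose_vecMulVec]
  have hb := bil_le W hWs (U.L m1 ⊔ U.L m2 ⊔ U.L m3) (vt1 - vstar) vt
    (Submodule.sub_mem _ (Submodule.mem_sup_right hm3)
      (Submodule.mem_sup_left (Submodule.mem_sup_left hm1)))
    (Submodule.mem_sup_left (Submodule.mem_sup_right hm2)) hvt_nrm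
  have hb2 := hb.trans (mul_le_mul_of_nonneg_right hF (nrm_nonneg (vt1 - vstar)))
  have hm := hmax vstar hvstar_mem hvstar_nrm
  have hcs := dot_le (vt1 - vstar) (vt - vstar)
  have e1 := nrm_sq vstar
  have e2 := nrm_sq vt
  have e3 := nrm_sq vt1
  rw [hvstar_nrm] at e1
  rw [hvt_nrm] at e2
  rw [hvt1_nrm] at e3
  have e4 := nrm_sq (vt - vstar)
  have e5 := nrm_sq (vt1 - vstar)
  rw [ip_eq] at hgood
  rw [ip_eq, ip_eq, hS] at hm
  simp only [add_mulVec, smul_mulVec, one_mulVec, vecMulVec_mulVec, dotProduct_add,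
    dotProduct_smul, smul_eq_mul, op_smul_eq_smul, ← e1, dotProduct_comm vstar vt] at hm
  simp only [sub_dotProduct, dotProduct_sub, ← e1, ← e2, ← e3, dotProduct_comm vstar vt,
    dotProduct_comm vstar vt1] at hcs e4 e5 hb2
  refine scalar_step lam _ (vt ⬝ᵥ vstar) _ _ hr hgap ht2 hgood (nrm_nonneg _) ?_
    (nrm_nonneg _) ?_
  · rw [e4]; ring
  · have e6 : nrm (vt1 - vstar) ^ 2 / 2 = 1 - vt1 ⬝ᵥ vstar := by rw [e5]; ring
    rw [e6]
    nlinarith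

end StructuredPCA
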